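/- Let f be an operator (1,h)-convex function on ℝ⁺ with f(0) = 0, where h is a nonnegative non-zero super-multiplicative function on an interval J ⊆ ℝ⁺ containing (0,1) satisfying 2 h(1/2) ≤ h(α)/α for all α ∈ (0,1). Then for any positive definite matrices A and B with A ≤ B, A⁻¹ f(A) ≤ 2 h(1/2) B⁻¹ f(B). -/

import Mathlib

open Matrix
open scoped ComplexOrder

/-- The matrix `A` raised to the real power `p`, defined via the continuous
functional calculus (using the real power function `Real.rpow`). -/
noncomputable def mpow {n : ℕ} (A : Matrix (Fin n) (Fin n) ℂ) (p : ℝ) :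
    Matrix (Fin n) (Fin n) ℂ :=
  cfc (fun x : ℝ => x ^ p) A

/-- The Loewner order on matrices: `loewnerLE X Y` iff `Y - X` is positive semidefinite. -/
def loewnerLE {n : ℕ} (X Y : Matrix (Fin n) (Fin n) ℂ) : Prop :=
  (Y - X).PosSemidef

/-- A set `K ⊆ ℝ` is `p`-convex if `(l*x^p + (1-l)*y^p)^(1/p) ∈ K` for all
`x, y ∈ K` and `l ∈ [0,1]`. -/
def PConvex (p : ℝ) (K : Set ℝ) : Prop :=
  ∀ x ∈ K, ∀ y ∈ K, ∀ l ∈ Set.Icc (0 : ℝ) 1,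
    (l * x ^ p + (1 - l) * y ^ p) ^ (1 / p) ∈ K

/-- `h` is super-multiplicative on `J`: `h (x*y) ≥ h x * h y` for all `x, y ∈ J`. -/
def SuperMultiplicativeOn (J : Set ℝ) (h : ℝ → ℝ) : Prop :=
  ∀ x ∈ J, ∀ y ∈ J, h x * h y ≤ h (x * y)

/-- `f` is operator `(p,h)`-convex on `K`: `f` is nonnegative and continuous on `K`, and
`f([α A^p + (1-α) B^p]^{1/p}) ≤ h(α) f(A) + h(1-α) f(B)` (in the Loewner order) for all
positive semidefinite matrices `A, B` (of any order `n`) with spectra in `K` and all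
`α ∈ (0,1)`, where matrix functions are taken via the continuous functional calculus. -/
def OperatorPHConvexOn (p : ℝ) (K : Set ℝ) (h : ℝ → ℝ) (f : ℝ → ℝ) : Prop :=
  (∀ x ∈ K, 0 ≤ f x) ∧ ContinuousOn f K ∧
  ∀ (n : ℕ) (A B : Matrix (Fin n) (Fin n) ℂ),
    A.PosSemidef → B.PosSemidef → spectrum ℝ A ⊆ K → spectrum ℝ B ⊆ K →
    ∀ α ∈ Set.Ioo (0 : ℝ) 1,
      loewnerLE (cfc f (mpow (α • mpow A p + (1 - α) • mpow B p) (1 / p)))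
        (h α • cfc f A + h (1 - α) • cfc f B)

/-- Functional calculus preserves intertwining relations between Hermitian matrices. -/
theorem cfc_mul_eq_mul_cfc {m k : Type*} [Fintype m] [DecidableEq m] [Fintype k] [DecidableEq k]
    (f : ℝ → ℝ) {Z : Matrix m m ℂ} {A : Matrix k k ℂ} (hZ : Z.IsHermitian) (hA : A.IsHermitian)
    {V : Matrix m k ℂ} (hV : Z * V = V * A) : cfc f Z * V = V * cfc f A := by
  classical
  have hfin : (spectrum ℝ Z ∪ spectrum ℝ A).Finite :=
    (Matrix.finite_real_spectrum).union Matrix.finite_real_spectrum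
  set q := Lagrange.interpolate hfin.toFinset id f
  have hq : ∀ x ∈ spectrum ℝ Z ∪ spectrum ℝ A, f x = q.eval x := fun x hx =>
    (Lagrange.eval_interpolate_at_node f (Set.injOn_id _) (hfin.mem_toFinset.2 hx)).symm
  rw [cfc_congr (a := Z) fun x hx => hq x (Or.inl hx),
    cfc_congr (a := A) fun x hx => hq x (Or.inr hx),
    cfc_polynomial q Z hZ.isSelfAdjoint, cfc_polynomial q A hA.isSelfAdjoint]
  induction q using Polynomial.induction_on' with
  | add p r hp hr => simp only [map_add, Matrix.add_mul, Matrix.mul_add, hp, hr]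
  | monomial j c =>
    simp only [Polynomial.aeval_monomial, ← Algebra.smul_def, Matrix.smul_mul, Matrix.mul_smul]
    congr 1
    induction j with
    | zero => simp
    | succ j ih => rw [pow_succ, Matrix.mul_assoc, hV, ← Matrix.mul_assoc, ih, pow_succ,
        Matrix.mul_assoc]

theorem cfc_conjTranspose_mul_mul {m k : Type*} [Fintype m] [DecidableEq m] [Fintype k]
    [DecidableEq k] (f : ℝ → ℝ) {Z : Matrix m m ℂ} (hZ : Z.IsHermitian) {V : Matrix m k ℂ}
    (hV : Vᴴ * V = 1) (hV' : V * Vᴴ = 1) : cfc f (Vᴴ * Z * V) = Vᴴ * cfc f Z * V := by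
  have := cfc_mul_eq_mul_cfc f hZ (isHermitian_conjTranspose_mul_mul V hZ)
    (V := V) (by simp only [← Matrix.mul_assoc, hV', Matrix.one_mul])
  rw [Matrix.mul_assoc Vᴴ (cfc f Z), this, ← Matrix.mul_assoc, hV, Matrix.one_mul]

theorem mpow_one {n : ℕ} {A : Matrix (Fin n) (Fin n) ℂ} (hA : A.IsHermitian) : mpow A 1 = A := by
  simp only [mpow, Real.rpow_one]
  exact cfc_id' ℝ A hA.isSelfAdjoint

theorem spectrum_subset_Ici {m : Type*} [Fintype m] [DecidableEq m] {A : Matrix m m ℂ}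
    (hA : A.PosSemidef) : spectrum ℝ A ⊆ Set.Ici 0 := by
  rw [hA.1.spectrum_real_eq_range_eigenvalues]
  exact Set.range_subset_iff.2 hA.eigenvalues_nonneg

theorem cfc_sqrt_mul_self {m : Type*} [Fintype m] [DecidableEq m] {A : Matrix m m ℂ}
    (hA : A.PosSemidef) : cfc Real.sqrt A * cfc Real.sqrt A = A := by
  rw [← cfc_mul Real.sqrt Real.sqrt A (Real.continuous_sqrt.continuousOn)
    (Real.continuous_sqrt.continuousOn)]
  conv_rhs => rw [← cfc_id' ℝ A hA.isHermitian.isSelfAdjoint]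
  exact cfc_congr fun x hx => Real.mul_self_sqrt (spectrum_subset_Ici hA hx)

theorem isHermitian_cfc {m : Type*} [Fintype m] [DecidableEq m] (f : ℝ → ℝ) (A : Matrix m m ℂ) :
    (cfc f A).IsHermitian :=
  cfc_predicate f A

/-- The midpoint inequality, over an arbitrary finite index type. -/
theorem OperatorPHConvexOn.midpoint {h f : ℝ → ℝ} (hf : OperatorPHConvexOn 1 (Set.Ici 0) h f)
    {m : Type*} [Fintype m] [DecidableEq m] {X Y : Matrix m m ℂ}
    (hX : X.PosSemidef) (hY : Y.PosSemidef) :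
    (h (1 / 2) • (cfc f X + cfc f Y) - cfc f ((1 / 2 : ℝ) • (X + Y))).PosSemidef := by
  let V : Matrix m (Fin (Fintype.card m)) ℂ :=
    (1 : Matrix m m ℂ).submatrix id (Fintype.equivFin m).symm
  have hV : Vᴴ * V = 1 := by
    simp only [V, conjTranspose_submatrix, conjTranspose_one]
    rw [← Matrix.submatrix_mul _ _ _ id _ Function.bijective_id, Matrix.one_mul]
    simp
  have hV' : V * Vᴴ = 1 := by
    simp only [V, conjTranspose_submatrix, conjTranspose_one]
    rw [← Matrix.submatrix_mul _ _ _ _ _ (Fintype.equivFin m).symm.bijective, Matrix.one_mul]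
    simp
  have hXY : (Vᴴ * ((1 / 2 : ℝ) • (X + Y)) * V).PosSemidef :=
    ((hX.add hY).smul (by norm_num : (0 : ℝ) ≤ 1 / 2)).conjTranspose_mul_mul_same V
  have hX' := hX.conjTranspose_mul_mul_same V
  have hY' := hY.conjTranspose_mul_mul_same V
  have key := hf.2.2 _ _ _ hX' hY' (spectrum_subset_Ici hX') (spectrum_subset_Ici hY')
    (1 / 2) ⟨by norm_num, by norm_num⟩
  have hmid : (1 / 2 : ℝ) • (Vᴴ * X * V) + (1 - 1 / 2 : ℝ) • (Vᴴ * Y * V)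
      = Vᴴ * ((1 / 2 : ℝ) • (X + Y)) * V := by
    norm_num [Matrix.mul_add, Matrix.add_mul]
  rw [mpow_one hX'.1, mpow_one hY'.1, hmid, div_one, mpow_one hXY.1,
    cfc_conjTranspose_mul_mul f hX.1 hV hV', cfc_conjTranspose_mul_mul f hY.1 hV hV',
    cfc_conjTranspose_mul_mul f ((hX.add hY).smul (by norm_num : (0 : ℝ) ≤ 1 / 2)).1 hV hV'] at key
  have hback := key.mul_mul_conjTranspose_same V
  have hcancel : ∀ M : Matrix m m ℂ, V * (Vᴴ * M * V) * Vᴴ = M := fun M => by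
    rw [Matrix.mul_assoc, Matrix.mul_assoc, Matrix.mul_assoc, hV', Matrix.mul_one,
      ← Matrix.mul_assoc, hV', Matrix.one_mul]
  have half : (1 - 1 / 2 : ℝ) = 1 / 2 := by norm_num
  simpa only [half, Matrix.mul_sub, Matrix.sub_mul, Matrix.mul_add, Matrix.add_mul,
    Matrix.mul_smul, Matrix.smul_mul, hcancel, ← smul_add] using hback

/-- A Jensen inequality for compressions by a contraction. -/
theorem OperatorPHConvexOn.compression {h f : ℝ → ℝ}
    (hf : OperatorPHConvexOn 1 (Set.Ici 0) h f) (hf0 : f 0 = 0)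
    {m : Type*} [Fintype m] [DecidableEq m] {B C : Matrix m m ℂ}
    (hB : B.PosSemidef) (hC : (1 - C * Cᴴ).PosSemidef) :
    ((2 * h (1 / 2)) • (Cᴴ * cfc f B * C) - cfc f (Cᴴ * B * C)).PosSemidef := by
  have hC' : (1 - Cᴴ * C).PosSemidef := by
    let _ : Invertible (1 : Matrix m m ℂ) := invertibleOne
    have h1 := (PosDef.fromBlocks₂₂ (1 : Matrix m m ℂ) C (D := 1) PosDef.one).2 (by simpa using hC)
    simpa using (PosDef.fromBlocks₁₁ C (1 : Matrix m m ℂ) (A := 1) PosDef.one).1 h1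
  set D := cfc Real.sqrt (1 - C * Cᴴ)
  set E := cfc Real.sqrt (1 - Cᴴ * C)
  have hD : Dᴴ = D := isHermitian_cfc _ _
  have hE : Eᴴ = E := isHermitian_cfc _ _
  have hDD : D * D = 1 - C * Cᴴ := cfc_sqrt_mul_self hC
  have hEE : E * E = 1 - Cᴴ * C := cfc_sqrt_mul_self hC'
  have hDC : D * C = C * E := cfc_mul_eq_mul_cfc Real.sqrt hC.1 hC'.1
    (by simp only [Matrix.sub_mul, Matrix.mul_sub, Matrix.one_mul, Matrix.mul_one, Matrix.mul_assoc])
  have hCD : Cᴴ * D = E * Cᴴ := by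
    simpa only [conjTranspose_mul, hD, hE] using congrArg conjTranspose hDC
  let U : Matrix (m ⊕ m) (m ⊕ m) ℂ := fromBlocks C D E (-Cᴴ)
  let S : Matrix (m ⊕ m) (m ⊕ m) ℂ := fromBlocks 1 0 0 (-1)
  let X : Matrix (m ⊕ m) (m ⊕ m) ℂ := fromBlocks B 0 0 0
  let V : Matrix (m ⊕ m) m ℂ := fromRows 1 0
  let W : Matrix (m ⊕ m) m ℂ := fromRows 0 1
  have hUU : Uᴴ * U = 1 := by
    simp only [U, fromBlocks_conjTranspose, fromBlocks_multiply, hD, hE, conjTranspose_neg,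
      conjTranspose_conjTranspose, Matrix.neg_mul, Matrix.mul_neg, hDD, hEE, hDC, hCD]
    simp
  have hUU' : U * Uᴴ = 1 := mul_eq_one_comm.1 hUU
  have hS : Sᴴ = S := by simp [S, fromBlocks_conjTranspose]
  have hSS : S * S = 1 := by simp [S, fromBlocks_multiply]
  have hSV : S * V = V := by simp [S, V, fromBlocks_mul_fromRows]
  have hVS : Vᴴ * S = Vᴴ := by
    simpa only [conjTranspose_mul, hS] using congrArg conjTranspose hSV
  have hVV : Vᴴ * V = 1 := by
    simp [V, conjTranspose_fromRows_eq_fromCols_conjTranspose, fromCols_mul_fromRows]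
  have hXV : X * V = V * B := by simp [X, V, fromBlocks_mul_fromRows, fromRows_mul]
  have hXW : X * W = W * (0 : Matrix m m ℂ) := by
    simp [X, W, fromBlocks_mul_fromRows]
  have hXpos : X.PosSemidef := by
    have : X = V * B * Vᴴ := by
      simp only [X, V, conjTranspose_fromRows_eq_fromCols_conjTranspose, fromRows_mul]
      ext (i | i) (j | j) <;> simp
    rw [this]
    exact hB.mul_mul_conjTranspose_same V
  have hfXV : cfc f X * V = V * cfc f B := cfc_mul_eq_mul_cfc f hXpos.1 hB.1 hXV
  have hfXW : cfc f X * W = 0 := by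
    rw [cfc_mul_eq_mul_cfc f hXpos.1 isHermitian_zero hXW, cfc_apply_zero, hf0]
    simp
  have hUV : U * V = V * C + W * E := by
    simp only [U, V, W, fromBlocks_mul_fromRows, fromRows_mul]
    ext (i | i) j <;> simp
  have hVW : Vᴴ * W = 0 := by
    simp [V, W, conjTranspose_fromRows_eq_fromCols_conjTranspose, fromCols_mul_fromRows]
  have hYpos := hXpos.conjTranspose_mul_mul_same U
  set Y := Uᴴ * X * U with hY
  have hZpos := hYpos.conjTranspose_mul_mul_same S
  have hfY : Vᴴ * cfc f Y * V = Cᴴ * cfc f B * C := by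
    have h1 : cfc f X * (U * V) = V * (cfc f B * C) := by
      rw [hUV, Matrix.mul_add, ← Matrix.mul_assoc, ← Matrix.mul_assoc, hfXV, hfXW, Matrix.zero_mul,
        add_zero, Matrix.mul_assoc]
    have h2 : Vᴴ * Uᴴ * V = Cᴴ := by
      have h3 : Vᴴ * (U * V) = C := by
        rw [hUV, Matrix.mul_add, ← Matrix.mul_assoc, ← Matrix.mul_assoc, hVV, hVW]
        simp
      simpa only [conjTranspose_mul, conjTranspose_conjTranspose] using congrArg conjTranspose h3
    calc Vᴴ * cfc f Y * V = Vᴴ * Uᴴ * (cfc f X * (U * V)) := by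
          rw [hY, cfc_conjTranspose_mul_mul f hXpos.1 hUU hUU']
          simp only [Matrix.mul_assoc]
      _ = Cᴴ * cfc f B * C := by rw [h1, ← Matrix.mul_assoc, h2, Matrix.mul_assoc]
  have hfZ : Vᴴ * cfc f (Sᴴ * Y * S) * V = Cᴴ * cfc f B * C := by
    rw [cfc_conjTranspose_mul_mul f hYpos.1 (by rw [hS, hSS]) (by rw [hS, hSS]), hS,
      ← hfY, Matrix.mul_assoc, Matrix.mul_assoc _ S V, hSV, Matrix.mul_assoc, ← Matrix.mul_assoc,
      hVS, Matrix.mul_assoc]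
  have hmid : ((1 / 2 : ℝ) • (Y + Sᴴ * Y * S)) * V = V * (Cᴴ * B * C) := by
    simp only [hY, hS, U, S, X, V, fromBlocks_conjTranspose, fromBlocks_multiply, hD, hE,
      fromBlocks_add, fromBlocks_smul, fromBlocks_mul_fromRows, fromRows_mul]
    simp [← two_smul ℝ, smul_smul]
  have hfmid := cfc_mul_eq_mul_cfc f ((hYpos.add hZpos).smul (by norm_num : (0 : ℝ) ≤ 1 / 2)).1
    (hB.conjTranspose_mul_mul_same C).1 hmid
  have key := (hf.midpoint hYpos hZpos).conjTranspose_mul_mul_same V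
  rw [Matrix.mul_sub, Matrix.sub_mul, Matrix.mul_assoc _ (cfc f _) V, hfmid, ← Matrix.mul_assoc Vᴴ V,
    hVV, Matrix.one_mul, Matrix.mul_smul, Matrix.smul_mul, Matrix.mul_add, Matrix.add_mul, hfY, hfZ,
    ← two_smul ℝ, smul_smul, mul_comm] at key
  exact key

/-- The square root `P` of a positive definite matrix `A` is invertible and
`A⁻¹ * f A = P⁻¹ * f A * P⁻¹`. -/
theorem PosDef.cfc_sqrt_inv {m : Type*} [Fintype m] [DecidableEq m] {A : Matrix m m ℂ}
    (hA : A.PosDef) (f : ℝ → ℝ) :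
    IsUnit (cfc Real.sqrt A) ∧
      A⁻¹ * cfc f A = (cfc Real.sqrt A)⁻¹ * cfc f A * (cfc Real.sqrt A)⁻¹ := by
  set P := cfc Real.sqrt A
  have hPP : P * P = A := cfc_sqrt_mul_self hA.posSemidef
  have hP : IsUnit P := ((Commute.refl P).isUnit_mul_iff.1 (hPP ▸ hA.isUnit)).1
  have hdet := (Matrix.isUnit_iff_isUnit_det P).1 hP
  have hc : P * cfc f A = cfc f A * P := cfc_commute_cfc _ _ A
  refine ⟨hP, ?_⟩
  have hc' : P⁻¹ * cfc f A = cfc f A * P⁻¹ := by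
    rw [← Matrix.mul_nonsing_inv_cancel_right P (P⁻¹ * cfc f A) hdet, Matrix.mul_assoc P⁻¹,
      ← hc, Matrix.nonsing_inv_mul_cancel_left P _ hdet]
  rw [Matrix.mul_assoc, ← hc', ← Matrix.mul_assoc, ← Matrix.mul_inv_rev, hPP]

/-- If `f` is operator `(1,h)`-convex on `ℝ⁺` with `f(0) = 0`, then for positive definite
matrices `A ≤ B`, `A⁻¹ f(A) ≤ 2 h(1/2) B⁻¹ f(B)`. -/
theorem stmt17
    (J : Set ℝ) (hJ : Set.Ioo (0 : ℝ) 1 ⊆ J) (hJpos : J ⊆ Set.Ici 0)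
    (h : ℝ → ℝ) (hh0 : ∀ x ∈ J, 0 ≤ h x) (hhne : ∃ x ∈ J, h x ≠ 0)
    (hsm : SuperMultiplicativeOn J h)
    (h2h : ∀ α ∈ Set.Ioo (0 : ℝ) 1, 2 * h (1 / 2) ≤ h α / α)
    (f : ℝ → ℝ) (hf : OperatorPHConvexOn 1 (Set.Ici 0) h f) (hf0 : f 0 = 0)
    (n : ℕ) (A B : Matrix (Fin n) (Fin n) ℂ) (hA : A.PosDef) (hB : B.PosDef)
    (hAB : loewnerLE A B) :
    loewnerLE (A⁻¹ * cfc f A) ((2 * h (1 / 2)) • (B⁻¹ * cfc f B)) := by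
  set P := cfc Real.sqrt A with hPdef
  set Q := cfc Real.sqrt B with hQdef
  obtain ⟨hP, hAf⟩ := PosDef.cfc_sqrt_inv hA f
  obtain ⟨hQ, hBf⟩ := PosDef.cfc_sqrt_inv hB f
  rw [← hPdef] at hP hAf
  rw [← hQdef] at hQ hBf
  have hPdet := (Matrix.isUnit_iff_isUnit_det P).1 hP
  have hQdet := (Matrix.isUnit_iff_isUnit_det Q).1 hQ
  have hPs : Pᴴ = P := isHermitian_cfc _ _
  have hQs : Qᴴ = Q := isHermitian_cfc _ _
  have hQi : (Q⁻¹)ᴴ = Q⁻¹ := by rw [conjTranspose_nonsing_inv, hQs]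
  have hPP : P * P = A := cfc_sqrt_mul_self hA.posSemidef
  have hQQ : Q * Q = B := cfc_sqrt_mul_self hB.posSemidef
  have hQBQ : Q⁻¹ * B * Q⁻¹ = 1 := by
    rw [← hQQ, Matrix.nonsing_inv_mul_cancel_left Q _ hQdet, Matrix.mul_nonsing_inv Q hQdet]
  have hC : (1 - (Q⁻¹ * P) * (Q⁻¹ * P)ᴴ).PosSemidef := by
    have h1 := PosSemidef.conjTranspose_mul_mul_same hAB Q⁻¹
    rw [hQi, Matrix.mul_sub, Matrix.sub_mul, hQBQ, ← hPP] at h1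
    simpa only [conjTranspose_mul, hPs, hQi, Matrix.mul_assoc] using h1
  have hCBC : (Q⁻¹ * P)ᴴ * B * (Q⁻¹ * P) = A := by
    calc (Q⁻¹ * P)ᴴ * B * (Q⁻¹ * P) = P * (Q⁻¹ * B * Q⁻¹) * P := by
          simp only [conjTranspose_mul, hPs, hQi, Matrix.mul_assoc]
      _ = A := by rw [hQBQ, Matrix.mul_one, hPP]
  have key := hf.compression hf0 hB.posSemidef hC
  have hPi : (P⁻¹)ᴴ = P⁻¹ := by rw [conjTranspose_nonsing_inv, hPs]
  have hfin := key.conjTranspose_mul_mul_same P⁻¹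
  have hcancel : P⁻¹ * ((Q⁻¹ * P)ᴴ * cfc f B * (Q⁻¹ * P)) * P⁻¹ = Q⁻¹ * cfc f B * Q⁻¹ := by
    simp only [conjTranspose_mul, hPs, hQi, Matrix.mul_assoc, Matrix.mul_nonsing_inv P hPdet,
      Matrix.mul_one, Matrix.nonsing_inv_mul_cancel_left P _ hPdet]
  rw [hCBC, hPi, Matrix.mul_sub, Matrix.sub_mul, Matrix.mul_smul, Matrix.smul_mul, hcancel,
    ← hAf, ← hBf] at hfin
  exact hfin
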